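/- Let m ≥ 0 be an integer and let f be a smooth function on ℝ^N ∖ {0} homogeneous of weight m + 1 − n/2. Then for every index A ∈ Fin N, Δ^m((D^{(m+1−n/2)} f)_A) = −X_A · Δ^{m+1} f on ℝ^N ∖ {0}. (This is the key inductive identity −Δ^m D_A f = X_A Δ^{m+1} f in the paper's proof that the flat GJMS operators factor through iterated tractor-D operators.) -/

import Mathlib

open scoped BigOperators

/-- Partial derivative in the `A`-th coordinate direction. -/
noncomputable def pd {N : ℕ} (A : Fin N) (f : (Fin N → ℝ) → ℝ) : (Fin N → ℝ) → ℝ :=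
  fun x => fderiv ℝ f x (Pi.single A 1)

/-- Ambient Laplacian `Δf = ∑_{A,B} h^{AB} ∂_A ∂_B f` w.r.t. the inverse metric `hInv`. -/
noncomputable def lap {N : ℕ} (hInv : Matrix (Fin N) (Fin N) ℝ)
    (f : (Fin N → ℝ) → ℝ) : (Fin N → ℝ) → ℝ :=
  fun x => ∑ A : Fin N, ∑ B : Fin N, hInv A B * pd A (pd B f) x

/-- `X_A(x) = ∑_B h_{AB} x^B`. -/
def Xc {N : ℕ} (h : Matrix (Fin N) (Fin N) ℝ) (A : Fin N) : (Fin N → ℝ) → ℝ :=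
  fun x => ∑ B : Fin N, h A B * x B

/-- `Q(x) = ∑_{A,B} h_{AB} x^A x^B`. -/
def Qfun {N : ℕ} (h : Matrix (Fin N) (Fin N) ℝ) : (Fin N → ℝ) → ℝ :=
  fun x => ∑ A : Fin N, ∑ B : Fin N, h A B * x A * x B

/-- Smooth (C^∞) on `ℝ^N ∖ {0}`. -/
def SmoothOffZero {N : ℕ} (f : (Fin N → ℝ) → ℝ) : Prop :=
  ContDiffOn ℝ (⊤ : ℕ∞) f {x : Fin N → ℝ | x ≠ 0}

/-- Homogeneous of weight `w` on `ℝ^N ∖ {0}`. -/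
def Homog {N : ℕ} (w : ℝ) (f : (Fin N → ℝ) → ℝ) : Prop :=
  ∀ x : Fin N → ℝ, x ≠ 0 → (∑ A : Fin N, x A * pd A f x) = w * f x

/-- Ambient tractor-D operator at weight `w`: `(D^{(w)} f)_A = (n+2w−2)∂_A f − X_A Δf`. -/
noncomputable def Dop {N : ℕ} (n : ℕ) (h hInv : Matrix (Fin N) (Fin N) ℝ) (w : ℝ)
    (f : (Fin N → ℝ) → ℝ) (A : Fin N) : (Fin N → ℝ) → ℝ :=
  fun x => ((n : ℝ) + 2 * w - 2) * pd A f x - Xc h A x * lap hInv f x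

/-- Iterated tractor-D: `seqD … w0 f A 0 = f` and
`seqD … w0 f A (j+1) = (D^{(w0−j)} (seqD … w0 f A j))_{A (j+1)}`. -/
noncomputable def seqD {N : ℕ} (n : ℕ) (h hInv : Matrix (Fin N) (Fin N) ℝ)
    (w0 : ℝ) (f : (Fin N → ℝ) → ℝ) (A : ℕ → Fin N) : ℕ → (Fin N → ℝ) → ℝ
  | 0 => f
  | j + 1 => Dop n h hInv (w0 - (j : ℝ)) (seqD n h hInv w0 f A j) (A (j + 1))

/-- `u` is `O(Q^m)`: `u = Q^m · g` for some smooth `g` on `ℝ^N ∖ {0}`. -/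
def BigOQ {N : ℕ} (h : Matrix (Fin N) (Fin N) ℝ) (m : ℕ) (u : (Fin N → ℝ) → ℝ) : Prop :=
  ∃ g : (Fin N → ℝ) → ℝ, SmoothOffZero g ∧
    ∀ x : Fin N → ℝ, x ≠ 0 → u x = (Qfun h x) ^ m * g x

section AmbientCalculus

open scoped Topology

variable {N : ℕ} {f g : (Fin N → ℝ) → ℝ} {x : Fin N → ℝ}

theorem isOpen_ne_zero : IsOpen {x : Fin N → ℝ | x ≠ 0} := isOpen_ne

theorem SmoothOffZero.contDiffAt (hf : SmoothOffZero f) (hx : x ≠ 0) :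
    ContDiffAt ℝ (⊤ : ℕ∞) f x :=
  ContDiffOn.contDiffAt hf (isOpen_ne_zero.mem_nhds hx)

theorem SmoothOffZero.differentiableAt (hf : SmoothOffZero f) (hx : x ≠ 0) :
    DifferentiableAt ℝ f x :=
  (hf.contDiffAt hx).differentiableAt (by simp)

theorem SmoothOffZero.differentiableAt_fderiv (hf : SmoothOffZero f) (hx : x ≠ 0) :
    DifferentiableAt ℝ (fderiv ℝ f) x :=
  ((hf.contDiffAt hx).fderiv_right (m := 1) (WithTop.coe_le_coe.2 le_top)).differentiableAt
    (by simp)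

theorem SmoothOffZero.pd (hf : SmoothOffZero f) (A : Fin N) : SmoothOffZero (pd A f) :=
  (ContDiffOn.fderiv_of_isOpen hf isOpen_ne_zero (m := (⊤ : ℕ∞)) (by simp)).clm_apply
    contDiffOn_const

theorem SmoothOffZero.lap (hf : SmoothOffZero f) (hInv : Matrix (Fin N) (Fin N) ℝ) :
    SmoothOffZero (lap hInv f) :=
  ContDiffOn.sum fun A _ => ContDiffOn.sum fun B _ => contDiffOn_const.mul ((hf.pd B).pd A)

theorem pd_congr_of_eqOn_ne_zero (hfg : ∀ y, y ≠ 0 → f y = g y) (hx : x ≠ 0) (A : Fin N) :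
    pd A f x = pd A g x := by
  have : f =ᶠ[𝓝 x] g := Filter.eventually_of_mem (isOpen_ne_zero.mem_nhds hx) hfg
  rw [pd, pd, this.fderiv_eq]

theorem lap_congr_of_eqOn_ne_zero (hInv : Matrix (Fin N) (Fin N) ℝ)
    (hfg : ∀ y, y ≠ 0 → f y = g y) (hx : x ≠ 0) : lap hInv f x = lap hInv g x := by
  refine Finset.sum_congr rfl fun A _ => Finset.sum_congr rfl fun B _ => ?_
  rw [pd_congr_of_eqOn_ne_zero (fun y hy => pd_congr_of_eqOn_ne_zero hfg hy B) hx A]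

theorem pd_pd_eq (hf : SmoothOffZero f) (hx : x ≠ 0) (A B : Fin N) :
    pd A (pd B f) x = fderiv ℝ (fderiv ℝ f) x (Pi.single A 1) (Pi.single B 1) := by
  have := ((hf.differentiableAt_fderiv hx).hasFDerivAt.clm_apply
    (hasFDerivAt_const (Pi.single B (1 : ℝ)) x)).fderiv
  change fderiv ℝ (fun y => fderiv ℝ f y (Pi.single B 1)) x (Pi.single A 1) = _
  rw [this]
  simp

theorem pd_comm (hf : SmoothOffZero f) (hx : x ≠ 0) (A B : Fin N) :
    pd A (pd B f) x = pd B (pd A f) x := by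
  rw [pd_pd_eq hf hx, pd_pd_eq hf hx]
  exact ((hf.contDiffAt hx).isSymmSndFDerivAt
    (by simpa using WithTop.coe_le_coe.2 (le_top : (2 : ℕ∞) ≤ ⊤))).eq _ _

theorem pd_lap (hInv : Matrix (Fin N) (Fin N) ℝ) (hf : SmoothOffZero f) (hx : x ≠ 0)
    (C : Fin N) : pd C (lap hInv f) x = lap hInv (pd C f) x := by
  have hd (A B : Fin N) : HasFDerivAt (fun y => hInv A B * pd A (pd B f) y)
      (hInv A B • fderiv ℝ (pd A (pd B f)) x) x :=
    (((hf.pd B).pd A).differentiableAt hx).hasFDerivAt.const_mul _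
  have hs := (HasFDerivAt.fun_sum (u := Finset.univ) fun A _ =>
    HasFDerivAt.fun_sum (u := Finset.univ) fun B _ => hd A B).fderiv
  change fderiv ℝ (fun y => ∑ A, ∑ B, hInv A B * pd A (pd B f) y) x (Pi.single C 1) = _
  rw [hs]
  simp only [sum_apply, smul_apply, smul_eq_mul]
  refine Finset.sum_congr rfl fun A _ => Finset.sum_congr rfl fun B _ => ?_
  change _ * pd C (pd A (pd B f)) x = _
  rw [pd_comm (hf.pd B) hx C A,
    pd_congr_of_eqOn_ne_zero (fun y hy => pd_comm hf hy C B) hx A]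

theorem hasFDerivAt_Xc (h : Matrix (Fin N) (Fin N) ℝ) (A : Fin N) (x : Fin N → ℝ) :
    HasFDerivAt (Xc h A)
      (∑ B, h A B • (ContinuousLinearMap.proj B : (Fin N → ℝ) →L[ℝ] ℝ)) x :=
  HasFDerivAt.fun_sum fun B _ => (hasFDerivAt_apply B x).const_mul _

theorem pd_Xc (h : Matrix (Fin N) (Fin N) ℝ) (A B : Fin N) (x : Fin N → ℝ) :
    pd B (Xc h A) x = h A B := by
  simp [pd, (hasFDerivAt_Xc h A x).fderiv, Pi.single_apply]

theorem pd_mul (hf : DifferentiableAt ℝ f x) (hg : DifferentiableAt ℝ g x) (A : Fin N) :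
    pd A (fun y => f y * g y) x = f x * pd A g x + pd A f x * g x := by
  simp [pd, fderiv_fun_mul hf hg, mul_comm]

theorem pd_const_mul (c : ℝ) (hf : DifferentiableAt ℝ f x) (A : Fin N) :
    pd A (fun y => c * f y) x = c * pd A f x := by
  simp [pd, fderiv_const_mul hf]

theorem pd_add (hf : DifferentiableAt ℝ f x) (hg : DifferentiableAt ℝ g x) (A : Fin N) :
    pd A (fun y => f y + g y) x = pd A f x + pd A g x := by
  simp [pd, fderiv_fun_add hf hg]

theorem pd_sub (hf : DifferentiableAt ℝ f x) (hg : DifferentiableAt ℝ g x) (A : Fin N) :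
    pd A (fun y => f y - g y) x = pd A f x - pd A g x := by
  simp [pd, fderiv_fun_sub hf hg]

theorem SmoothOffZero.const_mul (hf : SmoothOffZero f) (c : ℝ) :
    SmoothOffZero fun y => c * f y :=
  contDiffOn_const.mul hf

theorem SmoothOffZero.Xc_mul (hf : SmoothOffZero f) (h : Matrix (Fin N) (Fin N) ℝ)
    (A : Fin N) : SmoothOffZero fun y => Xc h A y * f y :=
  (ContDiffOn.sum fun B _ => contDiffOn_const.mul (contDiff_apply ℝ ℝ B).contDiffOn).mul hf

theorem lap_sub (hInv : Matrix (Fin N) (Fin N) ℝ) (hf : SmoothOffZero f)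
    (hg : SmoothOffZero g) (hx : x ≠ 0) :
    lap hInv (fun y => f y - g y) x = lap hInv f x - lap hInv g x := by
  simp only [lap, ← Finset.sum_sub_distrib]
  refine Finset.sum_congr rfl fun A _ => Finset.sum_congr rfl fun B _ => ?_
  rw [pd_congr_of_eqOn_ne_zero
    (fun y hy => pd_sub (hf.differentiableAt hy) (hg.differentiableAt hy) B) hx A,
    pd_sub ((hf.pd B).differentiableAt hx) ((hg.pd B).differentiableAt hx), mul_sub]

theorem lap_const_mul (hInv : Matrix (Fin N) (Fin N) ℝ) (c : ℝ) (hf : SmoothOffZero f)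
    (hx : x ≠ 0) : lap hInv (fun y => c * f y) x = c * lap hInv f x := by
  simp only [lap, Finset.mul_sum]
  refine Finset.sum_congr rfl fun A _ => Finset.sum_congr rfl fun B _ => ?_
  rw [pd_congr_of_eqOn_ne_zero
    (fun y hy => pd_const_mul c (hf.differentiableAt hy) B) hx A,
    pd_const_mul c ((hf.pd B).differentiableAt hx), mul_left_comm]

/-- The commutator identity `[Δ, X_A] = 2 ∂_A`. -/
theorem lap_Xc_mul {h hInv : Matrix (Fin N) (Fin N) ℝ} (hSymm : ∀ A B, h A B = h B A)
    (hInvh : h * hInv = 1) (hf : SmoothOffZero f) (hx : x ≠ 0) (A : Fin N) :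
    lap hInv (fun y => Xc h A y * f y) x = Xc h A x * lap hInv f x + 2 * pd A f x := by
  have hX (y : Fin N → ℝ) : DifferentiableAt ℝ (Xc h A) y :=
    (hasFDerivAt_Xc h A y).differentiableAt
  have hpd (B : Fin N) (y : Fin N → ℝ) (hy : y ≠ 0) :
      pd B (fun y => Xc h A y * f y) y = Xc h A y * pd B f y + h A B * f y := by
    rw [pd_mul (hX y) (hf.differentiableAt hy), pd_Xc]
  have hpd2 (B C : Fin N) : pd B (pd C fun y => Xc h A y * f y) x
      = Xc h A x * pd B (pd C f) x + h A B * pd C f x + h A C * pd B f x := by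
    rw [pd_congr_of_eqOn_ne_zero (hpd C) hx B,
      pd_add (((hf.pd C).Xc_mul h A).differentiableAt hx)
        ((hf.const_mul _).differentiableAt hx),
      pd_mul (hX x) ((hf.pd C).differentiableAt hx), pd_Xc,
      pd_const_mul _ (hf.differentiableAt hx)]
  have hleft (C : Fin N) : ∑ B, h A B * hInv B C = if A = C then 1 else 0 := by
    rw [← Matrix.mul_apply, hInvh, Matrix.one_apply]
  have hright (B : Fin N) : ∑ C, hInv B C * h A C = if A = B then 1 else 0 := by
    simp only [hSymm A]
    rw [← Matrix.mul_apply, mul_eq_one_comm.mp hInvh, Matrix.one_apply]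
    simp only [eq_comm]
  have hsum1 : ∑ B, ∑ C, hInv B C * (h A B * pd C f x) = pd A f x := by
    rw [Finset.sum_comm]
    calc _ = ∑ C, (∑ B, h A B * hInv B C) * pd C f x := by
          simp only [Finset.sum_mul]
          exact Finset.sum_congr rfl fun C _ => Finset.sum_congr rfl fun B _ => by ring
      _ = pd A f x := by simp [hleft]
  have hsum2 : ∑ B, ∑ C, hInv B C * (h A C * pd B f x) = pd A f x := by
    simp only [← mul_assoc, ← Finset.sum_mul, hright]
    simp
  simp only [lap, hpd2, mul_add, Finset.sum_add_distrib, hsum1, hsum2, Finset.mul_sum,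
    mul_left_comm (Xc h A x)]
  ring

/-- The Laplacian intertwines the tractor-D operators at weights `w` and `w - 1`. -/
theorem lap_Dop (n : ℕ) {h hInv : Matrix (Fin N) (Fin N) ℝ} (hSymm : ∀ A B, h A B = h B A)
    (hInvh : h * hInv = 1) (w : ℝ) (hf : SmoothOffZero f) (hx : x ≠ 0) (A : Fin N) :
    lap hInv (Dop n h hInv w f A) x = Dop n h hInv (w - 1) (lap hInv f) A x := by
  unfold Dop
  rw [lap_sub hInv ((hf.pd A).const_mul _) ((hf.lap hInv).Xc_mul h A) hx,
    lap_const_mul hInv _ (hf.pd A) hx, lap_Xc_mul hSymm hInvh (hf.lap hInv) hx, pd_lap hInv hf hx]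
  ring

theorem SmoothOffZero.iterate_lap (hf : SmoothOffZero f) (hInv : Matrix (Fin N) (Fin N) ℝ)
    (k : ℕ) : SmoothOffZero ((_root_.lap hInv)^[k] f) := by
  induction k with
  | zero => exact hf
  | succ k ih =>
    rw [Function.iterate_succ_apply']
    exact ih.lap hInv

theorem iterate_lap_Dop (n : ℕ) {h hInv : Matrix (Fin N) (Fin N) ℝ}
    (hSymm : ∀ A B, h A B = h B A) (hInvh : h * hInv = 1) (w : ℝ) (hf : SmoothOffZero f)
    (A : Fin N) (k : ℕ) (x : Fin N → ℝ) (hx : x ≠ 0) :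
    (lap hInv)^[k] (Dop n h hInv w f A) x
      = Dop n h hInv (w - k) ((lap hInv)^[k] f) A x := by
  induction k generalizing x with
  | zero => simp
  | succ k ih =>
    rw [Function.iterate_succ_apply', lap_congr_of_eqOn_ne_zero hInv ih hx,
      lap_Dop n hSymm hInvh _ (hf.iterate_lap hInv k) hx,
      ← Function.iterate_succ_apply' (lap hInv),
      Nat.cast_succ, sub_sub]

end AmbientCalculus

/-- for `f` homogeneous of weight `m+1−n/2`,
`Δ^m (D^{(m+1−n/2)} f)_A = −X_A Δ^{m+1} f` on `ℝ^N ∖ {0}`. -/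
theorem laplacian_pow_Dop
    (n : ℕ) (hn : 1 ≤ n)
    (h hInv : Matrix (Fin (n + 2)) (Fin (n + 2)) ℝ)
    (hSymm : ∀ A B, h A B = h B A) (hInvh : h * hInv = 1)
    (m : ℕ) (f : (Fin (n + 2) → ℝ) → ℝ) (hf : SmoothOffZero f)
    (hhom : Homog ((m : ℝ) + 1 - (n : ℝ) / 2) f)
    (A : Fin (n + 2)) :
    ∀ x : Fin (n + 2) → ℝ, x ≠ 0 →
      (lap hInv)^[m] (Dop n h hInv ((m : ℝ) + 1 - (n : ℝ) / 2) f A) x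
        = -(Xc h A x * (lap hInv)^[m + 1] f x) := by
  intro x hx
  rw [iterate_lap_Dop n hSymm hInvh _ hf A m x hx, Function.iterate_succ_apply', Dop]
  ring
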